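/- arXiv:1210.4681 — 2 statements merged into one kernel-verified Lean document; each statement's English description precedes it below -/
import Mathlib

section
/- Let F(x) = x₁x₂x₃(x₁²-x₂²)(x₂²-x₃²)(x₃²-x₁²)·(5(x₁⁴+x₂⁴+x₃⁴) - 13(x₁²x₂²+x₂²x₃²+x₃²x₁²)). Then for every polynomial f ∈ ℝ[x₁,x₂,x₃] satisfying e₂(∂)f = e₆(∂)f = e₄(∂)²f = 0, there exists a polynomial η ∈ ℝ[x₁,x₂,x₃] such that f = η(∂)F; that is, F generates the solution space Sol of this system as an ℝ[∂]-module. -/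
open MvPolynomial

noncomputable def dop (φ : MvPolynomial (Fin 3) ℝ) :
    MvPolynomial (Fin 3) ℝ →ₗ[ℝ] MvPolynomial (Fin 3) ℝ :=
  φ.support.sum fun s => φ.coeff s •
    (((pderiv (0 : Fin 3)).toLinearMap ^ s 0) *
     ((pderiv (1 : Fin 3)).toLinearMap ^ s 1) *
     ((pderiv (2 : Fin 3)).toLinearMap ^ s 2))

noncomputable def e2 : MvPolynomial (Fin 3) ℝ := X 0 ^ 2 + X 1 ^ 2 + X 2 ^ 2
noncomputable def e4 : MvPolynomial (Fin 3) ℝ :=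
  X 1 ^ 2 * X 2 ^ 2 + X 2 ^ 2 * X 0 ^ 2 + X 0 ^ 2 * X 1 ^ 2
noncomputable def e6 : MvPolynomial (Fin 3) ℝ := X 0 ^ 2 * X 1 ^ 2 * X 2 ^ 2

/-- The degree-13 generator of the solution space `Sol`. -/
noncomputable def F : MvPolynomial (Fin 3) ℝ :=
  X 0 * X 1 * X 2 * (X 0 ^ 2 - X 1 ^ 2) * (X 1 ^ 2 - X 2 ^ 2) * (X 2 ^ 2 - X 0 ^ 2) *
    (C 5 * (X 0 ^ 4 + X 1 ^ 4 + X 2 ^ 4) -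
     C 13 * (X 0 ^ 2 * X 1 ^ 2 + X 1 ^ 2 * X 2 ^ 2 + X 2 ^ 2 * X 0 ^ 2))

section DifferentialOperators

theorem pderiv_commute {σ R : Type*} [CommSemiring R] (i j : σ) :
    Commute (pderiv (R := R) i).toLinearMap (pderiv j).toLinearMap := by
  classical
  refine LinearMap.ext fun p => MvPolynomial.ext _ _ fun m => ?_
  rcases eq_or_ne i j with rfl | h
  · rfl
  · simp only [Module.End.mul_apply, Derivation.coeFn_coe, coeff_pderiv, Finsupp.add_apply,
      Finsupp.single_eq_of_ne h, Finsupp.single_eq_of_ne h.symm, add_zero, mul_assoc,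
      add_right_comm m, mul_comm, mul_left_comm]

/-- The monoid homomorphism sending the exponent of a monomial to its differential operator. -/
noncomputable def dopMonomial :
    Multiplicative (Fin 3 →₀ ℕ) →* Module.End ℝ (MvPolynomial (Fin 3) ℝ) where
  toFun s := (pderiv (0 : Fin 3)).toLinearMap ^ s.toAdd 0 *
    (pderiv (1 : Fin 3)).toLinearMap ^ s.toAdd 1 * (pderiv (2 : Fin 3)).toLinearMap ^ s.toAdd 2
  map_one' := by simp
  map_mul' s t := by
    simp only [toAdd_mul, Finsupp.add_apply, pow_add]
    have h01 := (pderiv_commute (R := ℝ) (0 : Fin 3) 1).pow_pow (t.toAdd 0) (s.toAdd 1)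
    have h02 := (pderiv_commute (R := ℝ) (0 : Fin 3) 2).pow_pow (t.toAdd 0) (s.toAdd 2)
    have h12 := (pderiv_commute (R := ℝ) (1 : Fin 3) 2).pow_pow (t.toAdd 1) (s.toAdd 2)
    rw [h01.mul_mul_mul_comm, (h02.mul_left h12).mul_mul_mul_comm]

/-- `dop` as an algebra homomorphism. -/
noncomputable def dopHom :
    MvPolynomial (Fin 3) ℝ →ₐ[ℝ] Module.End ℝ (MvPolynomial (Fin 3) ℝ) :=
  AddMonoidAlgebra.lift ℝ _ _ dopMonomial

theorem dop_eq_dopHom (φ : MvPolynomial (Fin 3) ℝ) : dop φ = dopHom φ :=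
  (AddMonoidAlgebra.lift_apply dopMonomial φ).symm

theorem dopHom_monomial (s : Fin 3 →₀ ℕ) (a : ℝ) :
    dopHom (monomial s a) = a • dopMonomial (.ofAdd s) :=
  AddMonoidAlgebra.lift_single ..

theorem dopHom_X (i : Fin 3) : dopHom (X i) = (pderiv i).toLinearMap := by
  rw [X, dopHom_monomial]
  fin_cases i <;> simp [dopMonomial]

theorem dopHom_mul_apply (φ ψ p : MvPolynomial (Fin 3) ℝ) :
    dopHom (φ * ψ) p = dopHom φ (dopHom ψ p) := by
  rw [map_mul, Module.End.mul_apply]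

theorem exists_coeff_pderiv_pow {σ : Type*} (i : σ) (k : ℕ) (n : σ →₀ ℕ) :
    ∃ c : ℝ, c ≠ 0 ∧ ∀ p : MvPolynomial σ ℝ,
      coeff n (((pderiv i).toLinearMap ^ k) p) = c * coeff (n + Finsupp.single i k) p := by
  induction k with
  | zero => exact ⟨1, one_ne_zero, by simp⟩
  | succ k ih =>
    obtain ⟨c, hc, h⟩ := ih
    refine ⟨c * ((n + Finsupp.single i k) i + 1 : ℕ), mul_ne_zero hc (by positivity), fun p => ?_⟩
    rw [pow_succ, Module.End.mul_apply, h, Derivation.coeFn_coe, coeff_pderiv, Finsupp.single_add,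
      add_assoc]
    push_cast
    ring

/-- A polynomial all of whose derivatives vanish at the origin is zero. -/
theorem eq_zero_of_forall_constantCoeff_dopHom {p : MvPolynomial (Fin 3) ℝ}
    (h : ∀ φ, constantCoeff (dopHom φ p) = 0) : p = 0 := by
  refine MvPolynomial.ext _ _ fun m => ?_
  have hm := h (monomial m 1)
  rw [dopHom_monomial, one_smul, constantCoeff_eq] at hm
  obtain ⟨a, ha, h0⟩ := exists_coeff_pderiv_pow (0 : Fin 3) (m 0) 0
  obtain ⟨b, hb, h1⟩ := exists_coeff_pderiv_pow (1 : Fin 3) (m 1) (Finsupp.single 0 (m 0))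
  obtain ⟨c, hc, h2⟩ := exists_coeff_pderiv_pow (2 : Fin 3) (m 2)
    (Finsupp.single 0 (m 0) + Finsupp.single 1 (m 1))
  have hsum : Finsupp.single 0 (m 0) + Finsupp.single 1 (m 1) + Finsupp.single 2 (m 2) = m := by
    ext i
    fin_cases i <;> simp
  simp only [dopMonomial, MonoidHom.coe_mk, OneHom.coe_mk, toAdd_ofAdd] at hm
  rw [Module.End.mul_apply, Module.End.mul_apply, h0, zero_add, h1, h2, hsum] at hm
  simpa [ha, hb, hc] using hm

end DifferentialOperators

section SocleNondegeneracy

variable {k Q : Type*} [Field k] [CommRing Q] [Algebra k Q]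

/-- The span of `V, V * x, …, V * x ^ (n - 1)`, as a set of sums. -/
def powSums (V : Set Q) (x : Q) (n : ℕ) : Set Q :=
  {v | ∃ a : Fin n → Q, (∀ i, a i ∈ V) ∧ v = ∑ i, a i * x ^ (i : ℕ)}

/-- A nonzero element of `V`, multiplied by `w`, pairs nontrivially under `l` with some element. -/
def PairsFaithfully (l : Q →ₗ[k] k) (w : Q) (V : Set Q) : Prop :=
  ∀ v ∈ V, (∀ t, l (v * w * t) = 0) → v = 0

theorem PairsFaithfully.powSums {l : Q →ₗ[k] k} {w x : Q} {V : Set Q} {n : ℕ}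
    (h : PairsFaithfully l (w * x ^ n) V) (hx : w * x ^ (n + 1) = 0) :
    PairsFaithfully l w (powSums V x (n + 1)) := by
  rintro _ ⟨a, ha, rfl⟩ hv
  have hzero (i : ℕ) : ∀ hi : i < n + 1, a ⟨i, hi⟩ = 0 := by
    induction i using Nat.strong_induction_on with
    | _ i ih =>
      intro hi
      refine h _ (ha _) fun t => ?_
      rw [← hv (x ^ (n - i) * t)]
      congr 1
      rw [Finset.sum_mul, Finset.sum_mul, Finset.sum_eq_single ⟨i, hi⟩]
      · have : x ^ n = x ^ i * x ^ (n - i) := by rw [← pow_add, Nat.add_sub_cancel' (by omega)]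
        rw [this]
        ring
      · rintro ⟨j, hj⟩ - hne
        rcases lt_or_gt_of_ne (fun h => hne (Fin.ext h) : j ≠ i) with hlt | hgt
        · rw [ih j hlt hj]
          ring
        · obtain ⟨d, hd⟩ : ∃ d, j + (n - i) = n + 1 + d := ⟨j + (n - i) - (n + 1), by omega⟩
          calc a ⟨j, hj⟩ * x ^ j * w * (x ^ (n - i) * t)
              = a ⟨j, hj⟩ * t * w * x ^ (j + (n - i)) := by ring
            _ = a ⟨j, hj⟩ * t * (w * x ^ (n + 1)) * x ^ d := by rw [hd]; ring
            _ = 0 := by rw [hx]; ring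
      · simp
  exact Finset.sum_eq_zero fun i _ => by rw [hzero i i.2, zero_mul]

/-- The relations satisfied by the coordinates `x, y, z` and `q = e₄` modulo `e₂, e₆, e₄²`. -/
structure SolRelations (x y z q : Q) : Prop where
  sq_q : q ^ 2 = 0
  pow_x : x ^ 6 = -(q * x ^ 2)
  pow_y : y ^ 4 = -q - x ^ 2 * y ^ 2 - x ^ 4
  pow_z : z ^ 2 = -(x ^ 2 + y ^ 2)

/-- The standard monomials modulo `SolRelations`. -/
def standardMonomial (x y z q : Q) (p : Fin 2 × Fin 6 × Fin 4 × Fin 2) : Q :=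
  z ^ (p.2.2.2 : ℕ) * y ^ (p.2.2.1 : ℕ) * x ^ (p.2.1 : ℕ) * q ^ (p.1 : ℕ)

theorem standardMonomial_mem_span (x y z q : Q) {a b c d : ℕ} (ha : a < 2) (hb : b < 6)
    (hc : c < 4) (hd : d < 2) :
    z ^ d * y ^ c * x ^ b * q ^ a ∈ Submodule.span k (Set.range (standardMonomial x y z q)) :=
  Submodule.subset_span ⟨(⟨a, ha⟩, ⟨b, hb⟩, ⟨c, hc⟩, ⟨d, hd⟩), rfl⟩

/-- The span of the standard monomials is stable under multiplication by `r` as soon as the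
standard monomials are mapped into it. -/
theorem mul_mem_span_standardMonomial {x y z q r : Q}
    (h : ∀ a b c d : ℕ, a < 2 → b < 6 → c < 4 → d < 2 → r * (z ^ d * y ^ c * x ^ b * q ^ a) ∈
      Submodule.span k (Set.range (standardMonomial x y z q)))
    {v : Q} (hv : v ∈ Submodule.span k (Set.range (standardMonomial x y z q))) :
    r * v ∈ Submodule.span k (Set.range (standardMonomial x y z q)) := by
  induction hv using Submodule.span_induction with
  | mem v hv =>
    obtain ⟨⟨a, b, c, d⟩, rfl⟩ := hv
    exact h a b c d a.2 b.2 c.2 d.2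
  | zero => simp
  | add v w _ _ hv hw => rw [mul_add]; exact add_mem hv hw
  | smul t v _ hv => rw [mul_smul_comm]; exact Submodule.smul_mem _ _ hv

namespace SolRelations

variable {x y z q : Q}

theorem q_mul_mem (hr : SolRelations x y z q) {v : Q}
    (hv : v ∈ Submodule.span k (Set.range (standardMonomial x y z q))) :
    q * v ∈ Submodule.span k (Set.range (standardMonomial x y z q)) := by
  refine mul_mem_span_standardMonomial (fun a b c d ha hb hc hd => ?_) hv
  interval_cases a
  · convert standardMonomial_mem_span x y z q one_lt_two hb hc hd using 1
    ring
  · convert zero_mem (Submodule.span k (Set.range (standardMonomial x y z q))) using 1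
    linear_combination z ^ d * y ^ c * x ^ b * hr.sq_q

theorem x_mul_mem (hr : SolRelations x y z q) {v : Q}
    (hv : v ∈ Submodule.span k (Set.range (standardMonomial x y z q))) :
    x * v ∈ Submodule.span k (Set.range (standardMonomial x y z q)) := by
  refine mul_mem_span_standardMonomial (fun a b c d ha hb hc hd => ?_) hv
  rcases eq_or_ne b 5 with rfl | hb5
  · convert neg_mem (hr.q_mul_mem
      (standardMonomial_mem_span (k := k) x y z q ha (by norm_num : 2 < 6) hc hd)) using 1
    linear_combination z ^ d * y ^ c * q ^ a * hr.pow_x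
  · convert standardMonomial_mem_span x y z q ha (by omega : b + 1 < 6) hc hd using 1
    ring

theorem y_mul_mem (hr : SolRelations x y z q) {v : Q}
    (hv : v ∈ Submodule.span k (Set.range (standardMonomial x y z q))) :
    y * v ∈ Submodule.span k (Set.range (standardMonomial x y z q)) := by
  refine mul_mem_span_standardMonomial (fun a b c d ha hb hc hd => ?_) hv
  rcases eq_or_ne c 3 with rfl | hc3
  · have h0 := standardMonomial_mem_span (k := k) x y z q ha hb (by norm_num : 0 < 4) hd
    have h2 := standardMonomial_mem_span (k := k) x y z q ha hb (by norm_num : 2 < 4) hd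
    convert sub_mem (sub_mem (neg_mem (hr.q_mul_mem h0)) (hr.x_mul_mem (hr.x_mul_mem h2)))
      (hr.x_mul_mem (hr.x_mul_mem (hr.x_mul_mem (hr.x_mul_mem h0)))) using 1
    linear_combination z ^ d * x ^ b * q ^ a * hr.pow_y
  · convert standardMonomial_mem_span x y z q ha hb (by omega : c + 1 < 4) hd using 1
    ring

theorem z_mul_mem (hr : SolRelations x y z q) {v : Q}
    (hv : v ∈ Submodule.span k (Set.range (standardMonomial x y z q))) :
    z * v ∈ Submodule.span k (Set.range (standardMonomial x y z q)) := by
  refine mul_mem_span_standardMonomial (fun a b c d ha hb hc hd => ?_) hv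
  interval_cases d
  · convert standardMonomial_mem_span x y z q ha hb hc one_lt_two using 1
    ring
  · have h := standardMonomial_mem_span (k := k) x y z q ha hb hc two_pos
    convert neg_mem (add_mem (hr.x_mul_mem (hr.x_mul_mem h)) (hr.y_mul_mem (hr.y_mul_mem h)))
      using 1
    linear_combination y ^ c * x ^ b * q ^ a * hr.pow_z

/-- The standard monomials span any algebra generated by three elements as in `SolRelations`. -/
theorem span_standardMonomial (hr : SolRelations x y z q)
    (π : MvPolynomial (Fin 3) k →ₐ[k] Q) (hπ : Function.Surjective π)
    (hx : π (X 0) = x) (hy : π (X 1) = y) (hz : π (X 2) = z) :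
    Submodule.span k (Set.range (standardMonomial x y z q)) = ⊤ := by
  refine Submodule.eq_top_iff'.2 fun v => ?_
  obtain ⟨p, rfl⟩ := hπ v
  induction p using MvPolynomial.induction_on with
  | C a =>
    rw [← MvPolynomial.algebraMap_eq, AlgHom.commutes, Algebra.algebraMap_eq_smul_one]
    refine Submodule.smul_mem _ _ ?_
    convert standardMonomial_mem_span x y z q two_pos (by norm_num : 0 < 6)
      (by norm_num : 0 < 4) two_pos using 1
    simp
  | add p p' hp hp' => rw [map_add]; exact add_mem hp hp'
  | mul_X p i hp =>
    rw [map_mul, mul_comm]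
    fin_cases i
    · exact hx ▸ hr.x_mul_mem hp
    · exact hy ▸ hr.y_mul_mem hp
    · exact hz ▸ hr.z_mul_mem hp

/-- If `l` does not vanish on the socle generator, the pairing `(v, t) ↦ l (v * t)` is
nondegenerate. -/
theorem eq_zero_of_forall_map_mul_eq_zero (hr : SolRelations x y z q)
    (hspan : Submodule.span k (Set.range (standardMonomial x y z q)) = ⊤)
    {l : Q →ₗ[k] k} (hl : l (q * x ^ 5 * y ^ 3 * z) ≠ 0) {v : Q} (hv : ∀ t, l (v * t) = 0) :
    v = 0 := by
  have h0 : PairsFaithfully l (1 * q ^ 1 * x ^ 5 * y ^ 3 * z ^ 1)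
      (Set.range (algebraMap k Q)) := by
    rintro _ ⟨c, rfl⟩ hc
    have := hc 1
    rw [mul_one, ← Algebra.smul_def, map_smul, smul_eq_mul, one_mul, pow_one, pow_one] at this
    rw [(mul_eq_zero.1 this).resolve_right hl, map_zero]
  have hx : q * x ^ 6 = 0 := by linear_combination q * hr.pow_x - x ^ 2 * hr.sq_q
  have hy : q * x ^ 5 * y ^ 4 = 0 := by
    linear_combination q * x ^ 5 * hr.pow_y - x ^ 5 * hr.sq_q - (x * y ^ 2 + x ^ 3) * hx
  have hz : q * x ^ 5 * y ^ 3 * z ^ 2 = 0 := by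
    linear_combination q * x ^ 5 * y ^ 3 * hr.pow_z - x * y ^ 3 * hx - y * hy
  have h := (((h0.powSums (by linear_combination hz)).powSums
    (by linear_combination hy)).powSums (by linear_combination hx)).powSums
    (by linear_combination hr.sq_q)
  refine h v ?_ fun t => by rw [mul_one, hv]
  obtain ⟨c, rfl⟩ := (Submodule.mem_span_range_iff_exists_fun k).1
    (hspan ▸ Submodule.mem_top : v ∈ Submodule.span k (Set.range (standardMonomial x y z q)))
  refine ⟨_, fun a => ⟨_, fun b => ⟨_, fun d => ⟨fun e => algebraMap k Q (c (a, b, d, e)),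
    fun e => ⟨_, rfl⟩, rfl⟩, rfl⟩, rfl⟩, ?_⟩
  simp only [Fintype.sum_prod_type, standardMonomial, Finset.sum_mul, Algebra.smul_def, mul_assoc]

/-- Every functional on the quotient is represented by the pairing. -/
theorem exists_forall_eq_map_mul (hr : SolRelations x y z q)
    (hspan : Submodule.span k (Set.range (standardMonomial x y z q)) = ⊤)
    {l : Q →ₗ[k] k} (hl : l (q * x ^ 5 * y ^ 3 * z) ≠ 0) (m : Q →ₗ[k] k) :
    ∃ r, ∀ t, m t = l (t * r) := by
  have : FiniteDimensional k Q := .of_fg_top (hspan ▸ Submodule.fg_span (Set.finite_range _))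
  let B : Q →ₗ[k] Module.Dual k Q := (LinearMap.mul k Q).compr₂ l
  have hB : Function.Injective B := (injective_iff_map_eq_zero B).2 fun v hv =>
    hr.eq_zero_of_forall_map_mul_eq_zero hspan hl fun t => LinearMap.congr_fun hv t
  obtain ⟨r, hr⟩ := (LinearMap.injective_iff_surjective_of_finrank_eq_finrank
    (Subspace.dual_finrank_eq).symm).1 hB m
  exact ⟨r, fun t => by rw [← hr, mul_comm]; rfl⟩

end SolRelations

end SocleNondegeneracy

section Generator

/-- The monomial `x₁ ^ a * x₂ ^ b * x₃ ^ c`. -/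
noncomputable def mono (a b c : ℕ) : MvPolynomial (Fin 3) ℝ := X 0 ^ a * X 1 ^ b * X 2 ^ c

theorem pderiv_pow_mul_X_pow {σ R : Type*} [CommSemiring R] {i : σ} {p : MvPolynomial σ R}
    (hp : pderiv i p = 0) (n a : ℕ) : ((pderiv i).toLinearMap ^ n) (p * X i ^ a) =
      (a.descFactorial n : R) • (p * X i ^ (a - n)) := by
  induction n with
  | zero => simp
  | succ n ih =>
    rw [pow_succ', Module.End.mul_apply, ih, map_smul, Derivation.coeFn_coe, pderiv_mul, hp,
      pderiv_pow, pderiv_X_self, Nat.descFactorial_succ, Nat.sub_sub, Nat.cast_mul,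
      ← map_natCast (C : R →+* MvPolynomial σ R)]
    simp only [smul_eq_C_mul, map_mul]
    ring

theorem dopHom_mono_mono (i j k a b c : ℕ) : dopHom (mono i j k) (mono a b c) =
    ((a.descFactorial i * b.descFactorial j * c.descFactorial k : ℕ) : ℝ) •
      mono (a - i) (b - j) (c - k) := by
  have h2 := pderiv_pow_mul_X_pow (R := ℝ) (i := (2 : Fin 3)) (p := X 0 ^ a * X 1 ^ b)
    (by simp) k c
  have h1 := pderiv_pow_mul_X_pow (R := ℝ) (i := (1 : Fin 3)) (p := X 0 ^ a * X 2 ^ (c - k))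
    (by simp) j b
  have h0 := pderiv_pow_mul_X_pow (R := ℝ) (i := (0 : Fin 3)) (p := X 1 ^ (b - j) * X 2 ^ (c - k))
    (by simp) i a
  rw [mono, mono, mono, map_mul dopHom, map_mul dopHom, map_pow, map_pow, map_pow, dopHom_X, dopHom_X, dopHom_X,
    Module.End.mul_apply, Module.End.mul_apply, h2, map_smul, mul_right_comm, h1, map_smul,
    map_smul, mul_right_comm, mul_assoc, mul_comm (X 0 ^ a), h0, smul_smul, smul_smul]
  push_cast
  congr 1
  · ring
  · ring

theorem e2_eq_mono : e2 = mono 2 0 0 + mono 0 2 0 + mono 0 0 2 := by simp [e2, mono]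

theorem e4_eq_mono : e4 = mono 0 2 2 + mono 2 0 2 + mono 2 2 0 := by
  simp [e4, mono, mul_comm]

theorem e6_eq_mono : e6 = mono 2 2 2 := rfl

theorem F_eq_mono : F = (5 : ℝ) • (mono 3 9 1 - mono 9 3 1 + mono 1 3 9 - mono 1 9 3 +
    mono 9 1 3 - mono 3 1 9) + (18 : ℝ) • (mono 7 5 1 - mono 5 7 1 + mono 1 7 5 - mono 1 5 7 +
    mono 5 1 7 - mono 7 1 5) := by
  simp only [F, mono, smul_eq_C_mul, map_ofNat]
  ring

theorem dopHom_e2_F : dopHom e2 F = 0 := by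
  simp only [e2_eq_mono, F_eq_mono, map_add, map_sub, map_smul, LinearMap.add_apply,
    dopHom_mono_mono]
  simp [Nat.descFactorial]
  module

theorem dopHom_e4_sq_F : dopHom (e4 ^ 2) F = 0 := by
  simp only [e4_eq_mono, F_eq_mono, map_add, map_sub, map_smul, LinearMap.add_apply,
    dopHom_mono_mono, pow_two, Module.End.mul_apply, map_mul]
  simp [Nat.descFactorial]

theorem dopHom_e6_F : dopHom e6 F = 0 := by
  simp only [e6_eq_mono, F_eq_mono, map_add, map_sub, map_smul, dopHom_mono_mono]
  simp [Nat.descFactorial]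

theorem constantCoeff_dopHom_socle_F :
    constantCoeff (dopHom (e4 * X 0 ^ 5 * X 1 ^ 3 * X 2) F) ≠ 0 := by
  have : e4 * X 0 ^ 5 * X 1 ^ 3 * X 2 = mono 5 5 3 + mono 7 3 3 + mono 7 5 1 := by
    simp only [e4, mono]
    ring
  simp only [this, F_eq_mono, map_add, map_sub, map_smul, LinearMap.add_apply, dopHom_mono_mono]
  simp [Nat.descFactorial, mono]

end Generator

/-- The ideal generated by `e₂`, `e₆` and `e₄²`. -/
noncomputable def solIdeal : Ideal (MvPolynomial (Fin 3) ℝ) := Ideal.span {e2, e6, e4 ^ 2}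

theorem dopHom_eq_zero_of_mem_solIdeal {p : MvPolynomial (Fin 3) ℝ} (h2 : dopHom e2 p = 0)
    (h6 : dopHom e6 p = 0) (h4 : dopHom (e4 ^ 2) p = 0) {φ : MvPolynomial (Fin 3) ℝ}
    (hφ : φ ∈ solIdeal) : dopHom φ p = 0 := by
  induction hφ using Submodule.span_induction with
  | mem φ hφ => rcases hφ with rfl | rfl | rfl <;> assumption
  | zero => simp
  | add φ ψ _ _ hφ hψ => rw [map_add, LinearMap.add_apply, hφ, hψ, add_zero]
  | smul ψ φ _ hφ => rw [smul_eq_mul, dopHom_mul_apply, hφ, map_zero]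

/-- A solution `p` of the system gives a functional on the quotient by `solIdeal`. -/
theorem exists_functional {p : MvPolynomial (Fin 3) ℝ} (h2 : dopHom e2 p = 0)
    (h6 : dopHom e6 p = 0) (h4 : dopHom (e4 ^ 2) p = 0) :
    ∃ l : (MvPolynomial (Fin 3) ℝ ⧸ solIdeal) →ₗ[ℝ] ℝ,
      ∀ φ, l (Ideal.Quotient.mkₐ ℝ solIdeal φ) = constantCoeff (dopHom φ p) := by
  let l₀ : MvPolynomial (Fin 3) ℝ →ₗ[ℝ] ℝ := lcoeff ℝ 0 ∘ₗ dopHom.toLinearMap.flip p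
  have hl₀ : solIdeal.restrictScalars ℝ ≤ LinearMap.ker l₀ := fun φ hφ => by
    rw [LinearMap.mem_ker]
    change coeff 0 (dopHom φ p) = 0
    rw [dopHom_eq_zero_of_mem_solIdeal h2 h6 h4 hφ, coeff_zero]
  exact ⟨(solIdeal.restrictScalars ℝ).liftQ l₀ hl₀ ∘ₗ
    (Submodule.Quotient.restrictScalarsEquiv ℝ solIdeal).symm.toLinearMap, fun φ => rfl⟩

theorem solRelations_mk : SolRelations (Ideal.Quotient.mkₐ ℝ solIdeal (X 0))
    (Ideal.Quotient.mkₐ ℝ solIdeal (X 1)) (Ideal.Quotient.mkₐ ℝ solIdeal (X 2))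
    (Ideal.Quotient.mkₐ ℝ solIdeal e4) := by
  have hmem {φ} (h : φ ∈ ({e2, e6, e4 ^ 2} : Set (MvPolynomial (Fin 3) ℝ))) :
      Ideal.Quotient.mkₐ ℝ solIdeal φ = 0 :=
    Ideal.Quotient.eq_zero_iff_mem.2 (Ideal.subset_span h)
  have h2 := hmem (φ := e2) (by simp)
  have h6 := hmem (φ := e6) (by simp)
  have h4 := hmem (φ := e4 ^ 2) (by simp)
  set π := Ideal.Quotient.mkₐ ℝ solIdeal
  have hq : π e4 = π (X 1) ^ 2 * π (X 2) ^ 2 + π (X 2) ^ 2 * π (X 0) ^ 2 +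
      π (X 0) ^ 2 * π (X 1) ^ 2 := by simp only [e4, map_add, map_mul, map_pow]
  simp only [e2, e6, map_add, map_mul, map_pow] at h2 h6 h4
  exact
    { sq_q := h4
      pow_x := by linear_combination π (X 0) ^ 4 * h2 + h6 + π (X 0) ^ 2 * hq
      pow_y := by linear_combination (π (X 0) ^ 2 + π (X 1) ^ 2) * h2 + hq
      pow_z := by linear_combination h2 }

theorem F_generates_Sol (f : MvPolynomial (Fin 3) ℝ)
    (h2 : dop e2 f = 0) (h6 : dop e6 f = 0) (h44 : dop e4 (dop e4 f) = 0) :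
    ∃ η : MvPolynomial (Fin 3) ℝ, f = dop η F := by
  simp only [dop_eq_dopHom] at h2 h6 h44 ⊢
  obtain ⟨l, hl⟩ := exists_functional dopHom_e2_F dopHom_e6_F dopHom_e4_sq_F
  obtain ⟨m, hm⟩ := exists_functional h2 h6 (by rw [pow_two, dopHom_mul_apply, h44])
  have hπ := Ideal.Quotient.mkₐ_surjective ℝ solIdeal
  obtain ⟨r, hr⟩ := solRelations_mk.exists_forall_eq_map_mul
    (solRelations_mk.span_standardMonomial _ hπ rfl rfl rfl) (l := l)
    (by simpa only [← map_pow, ← map_mul, hl] using constantCoeff_dopHom_socle_F) m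
  obtain ⟨η, rfl⟩ := hπ r
  refine ⟨η, sub_eq_zero.1 (eq_zero_of_forall_constantCoeff_dopHom fun φ => ?_)⟩
  rw [map_sub, map_sub, ← dopHom_mul_apply, ← hl, ← hm, hr, ← map_mul, sub_self]
end

section
/- The octic polynomial χ₁(r) = 16r⁸ + 32r⁷ + 40r⁶ - 48r⁵ - 396r⁴ - 432r³ - 810r² - 972r - 729 has exactly one positive real root, and this root lies in the open interval (2.245, 2.246). -/
/-- The octic polynomial arising in the edge problem for isohedral triakis
octahedra. -/
noncomputable def χ₁ (r : ℝ) : ℝ :=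
  16 * r ^ 8 + 32 * r ^ 7 + 40 * r ^ 6 - 48 * r ^ 5 - 396 * r ^ 4 -
    432 * r ^ 3 - 810 * r ^ 2 - 972 * r - 729

/-- The function `r ↦ χ₁ r / r ^ 5` is strictly increasing on the positive reals, in a
division-free form. -/
theorem pow_mul_χ₁_lt {a b : ℝ} (ha : 0 < a) (hab : a < b) : b ^ 5 * χ₁ a < a ^ 5 * χ₁ b := by
  have hb : 0 < b := ha.trans hab
  have hpow (n : ℕ) (hn : n ≠ 0) : 0 < b ^ n - a ^ n :=
    sub_pos.2 (pow_lt_pow_left₀ hab ha.le hn)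
  have h1 := sub_pos.2 hab
  have h2 := hpow 2 (by norm_num)
  have h3 := hpow 3 (by norm_num)
  have h4 := hpow 4 (by norm_num)
  have h5 := hpow 5 (by norm_num)
  have key : a ^ 5 * χ₁ b - b ^ 5 * χ₁ a =
      16 * (a ^ 5 * b ^ 5) * (b ^ 3 - a ^ 3) + 32 * (a ^ 5 * b ^ 5) * (b ^ 2 - a ^ 2) +
        40 * (a ^ 5 * b ^ 5) * (b - a) + 396 * (a ^ 4 * b ^ 4) * (b - a) +
        432 * (a ^ 3 * b ^ 3) * (b ^ 2 - a ^ 2) + 810 * (a ^ 2 * b ^ 2) * (b ^ 3 - a ^ 3) +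
        972 * (a * b) * (b ^ 4 - a ^ 4) + 729 * (b ^ 5 - a ^ 5) := by
    unfold χ₁
    ring
  rw [← sub_pos, key]
  positivity

theorem octic_unique_positive_root :
    ∃ x : ℝ, (0 < x ∧ χ₁ x = 0) ∧ (∀ y : ℝ, 0 < y → χ₁ y = 0 → y = x) ∧
      2.245 < x ∧ x < 2.246 := by
  have hcont : ContinuousOn χ₁ (Set.Icc 2.245 2.246) := by
    unfold χ₁
    fun_prop
  obtain ⟨x, ⟨hx1, hx2⟩, hx⟩ := intermediate_value_Ioo (by norm_num) hcont
    (show (0 : ℝ) ∈ Set.Ioo (χ₁ 2.245) (χ₁ 2.246) by constructor <;> norm_num [χ₁])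
  have hx0 : 0 < x := lt_trans (by norm_num) hx1
  refine ⟨x, ⟨hx0, hx⟩, fun y hy0 hy => ?_, hx1, hx2⟩
  rcases lt_trichotomy y x with h | h | h
  · simpa [hx, hy] using pow_mul_χ₁_lt hy0 h
  · exact h
  · simpa [hx, hy] using pow_mul_χ₁_lt hx0 h
end
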